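/- arXiv:1409.4524 — 2 statements merged into one kernel-verified Lean document; each statement's English description precedes it below -/
import Mathlib

section
/- Assume n = 3, M is irreducible, ρ(M) = 0, every matrix in M is invertible, and Condition G holds; let v be a Barabanov norm with unit sphere S. Let Γ ⊆ S be the image of a periodic v-extremal solution, and let S₁ be a connected component of S \ Γ. If z is a v-extremal solution with z(0) ∈ S₁, then z(t) ∈ S₁ ∪ Γ for every t ≥ 0; moreover, if z(t*) ∈ Γ for some t* ≥ 0, then z(t) ∈ Γ for all t ≥ t*. -/
open MeasureTheory Filter Topology RealInnerProductSpace Matrix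

noncomputable section

abbrev Vec (n : ℕ) := EuclideanSpace ℝ (Fin n)

def mulE {n : ℕ} (A : Matrix (Fin n) (Fin n) ℝ) (y : Vec n) : Vec n :=
  Matrix.toEuclideanLin A y

def IsSolutionWith {n : ℕ} (M : Set (Matrix (Fin n) (Fin n) ℝ))
    (A : ℝ → Matrix (Fin n) (Fin n) ℝ) (x : ℝ → Vec n) : Prop :=
  (∀ i j, Measurable fun t => A t i j) ∧ (∀ t, A t ∈ M) ∧
    ContinuousOn x (Set.Ici 0) ∧
    ∀ t ≥ (0:ℝ), x t = x 0 + ∫ s in (0:ℝ)..t, mulE (A s) (x s)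

def IsSolution {n : ℕ} (M : Set (Matrix (Fin n) (Fin n) ℝ)) (x : ℝ → Vec n) : Prop :=
  ∃ A, IsSolutionWith M A x

def IsAdjointWith {n : ℕ} (A : ℝ → Matrix (Fin n) (Fin n) ℝ) (l : ℝ → Vec n) : Prop :=
  ContinuousOn l (Set.Ici 0) ∧
    ∀ t ≥ (0:ℝ), l t = l 0 - ∫ s in (0:ℝ)..t, mulE ((A s)ᵀ) (l s)

def IsNorm {n : ℕ} (v : Vec n → ℝ) : Prop :=
  (∀ x, v x = 0 ↔ x = 0) ∧ (∀ (a : ℝ) (x : Vec n), v (a • x) = |a| * v x) ∧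
    ∀ x y, v (x + y) ≤ v x + v y

def IsBarabanov {n : ℕ} (M : Set (Matrix (Fin n) (Fin n) ℝ)) (v : Vec n → ℝ) : Prop :=
  IsNorm v ∧ (∀ x, IsSolution M x → ∀ t ≥ (0:ℝ), v (x t) ≤ v (x 0)) ∧
    ∀ y : Vec n, ∃ x, IsSolution M x ∧ x 0 = y ∧ ∀ t ≥ (0:ℝ), v (x t) = v y

def IsExtremal {n : ℕ} (M : Set (Matrix (Fin n) (Fin n) ℝ)) (v : Vec n → ℝ)
    (x : ℝ → Vec n) : Prop :=
  IsSolution M x ∧ ∀ t ≥ (0:ℝ), v (x t) = v (x 0)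

def subdiff {n : ℕ} (v : Vec n → ℝ) (x : Vec n) : Set (Vec n) :=
  {l | ⟪l, x⟫ = v x ∧ ∀ y, ⟪l, y⟫ ≤ v y}

def MIrreducible {n : ℕ} (M : Set (Matrix (Fin n) (Fin n) ℝ)) : Prop :=
  ∀ W : Submodule ℝ (Vec n), (∀ A ∈ M, ∀ x ∈ W, mulE A x ∈ W) → W = ⊥ ∨ W = ⊤

def rhoZero {n : ℕ} (M : Set (Matrix (Fin n) (Fin n) ℝ)) : Prop :=
  sSup {r : EReal | ∃ x, IsSolution M x ∧ x 0 ≠ 0 ∧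
      r = limsup (fun t => ((Real.log ‖x t‖ / t : ℝ) : EReal)) atTop} = 0

def MaxCondWith {n : ℕ} (M : Set (Matrix (Fin n) (Fin n) ℝ))
    (A : ℝ → Matrix (Fin n) (Fin n) ℝ) (x l : ℝ → Vec n) : Prop :=
  ∀ᵐ t ∂(volume.restrict (Set.Ici (0:ℝ))),
    ∀ B ∈ M, ⟪l t, mulE B (x t)⟫ ≤ ⟪l t, mulE (A t) (x t)⟫

def ConditionG {n : ℕ} (M : Set (Matrix (Fin n) (Fin n) ℝ)) : Prop :=
  ∀ (x₀ l₀ : Vec n), x₀ ≠ 0 → l₀ ≠ 0 →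
  ∀ A₁ A₂ (x₁ x₂ l₁ l₂ : ℝ → Vec n),
    IsSolutionWith M A₁ x₁ → IsSolutionWith M A₂ x₂ →
    IsAdjointWith A₁ l₁ → IsAdjointWith A₂ l₂ →
    x₁ 0 = x₀ → x₂ 0 = x₀ → l₁ 0 = l₀ → l₂ 0 = l₀ →
    MaxCondWith M A₁ x₁ l₁ → MaxCondWith M A₂ x₂ l₂ →
    ∀ t ≥ (0:ℝ), x₁ t = x₂ t ∧ l₁ t = l₂ t

def omegaLimitSet {n : ℕ} (x : ℝ → Vec n) : Set (Vec n) :=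
  {p | ∃ tk : ℕ → ℝ, Tendsto tk atTop atTop ∧ Tendsto (fun k => x (tk k)) atTop (𝓝 p)}

/-- Applying a bounded measurable field of operators to a curve that is continuous on `[0, ∞)`
gives an integrable function on bounded intervals. -/
lemma intervalIntegrable_clm_apply {F : Type*} [NormedAddCommGroup F] [NormedSpace ℝ F]
    {B : ℝ → F →L[ℝ] F} (hB : StronglyMeasurable B) {C : ℝ} (hC : ∀ s, ‖B s‖ ≤ C)
    {x : ℝ → F} (hx : ContinuousOn x (Set.Ici 0)) {a b : ℝ} (ha : 0 ≤ a) (hb : 0 ≤ b) :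
    IntervalIntegrable (fun s => B s (x s)) volume a b := by
  have hsub : Set.uIcc a b ⊆ Set.Ici 0 := fun s hs => (le_min ha hb).trans hs.1
  obtain ⟨D, hD⟩ := isCompact_uIcc.exists_bound_of_continuousOn (hx.mono hsub)
  have hC0 : 0 ≤ C := (norm_nonneg _).trans (hC 0)
  refine (intervalIntegrable_const (c := C * D)).mono_fun ?_ ?_
  · have h1 : AEStronglyMeasurable x (volume.restrict (Set.uIoc a b)) :=
      (hx.mono (Set.uIoc_subset_uIcc.trans hsub)).aestronglyMeasurable measurableSet_uIoc
    exact isBoundedBilinearMap_apply.continuous.comp_aestronglyMeasurable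
      (hB.aestronglyMeasurable.prodMk h1)
  · filter_upwards [ae_restrict_mem measurableSet_uIoc] with s hs
    refine ((B s).le_opNorm _).trans (le_trans ?_ (le_abs_self _))
    exact mul_le_mul (hC s) (hD s (Set.uIoc_subset_uIcc hs)) (norm_nonneg _) hC0

lemma norm_integral_exp_smul_le {F : Type*} [NormedAddCommGroup F] [NormedSpace ℝ F]
    {k D τ : ℝ} (hk : 0 < k) (hτ : 0 ≤ τ) {w : ℝ → F} (hw : ∀ s, ‖w s‖ ≤ D) :
    ‖∫ s in (0:ℝ)..τ, Real.exp (k * s) • w s‖ ≤ D / k * Real.exp (k * τ) := by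
  have hD : 0 ≤ D := (norm_nonneg _).trans (hw 0)
  have h1 : ‖∫ s in (0:ℝ)..τ, Real.exp (k * s) • w s‖
      ≤ ∫ s in (0:ℝ)..τ, D * Real.exp (k * s) := by
    refine intervalIntegral.norm_integral_le_of_norm_le hτ (Eventually.of_forall fun s _ => ?_)
      (Continuous.intervalIntegrable (by fun_prop) _ _)
    rw [norm_smul, Real.norm_eq_abs, Real.abs_exp, mul_comm]
    gcongr
    exact hw s
  refine h1.trans ?_
  rw [intervalIntegral.integral_const_mul, intervalIntegral.integral_comp_mul_left _ hk.ne',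
    integral_exp]
  simp only [mul_zero, Real.exp_zero, smul_eq_mul]
  rw [div_mul_eq_mul_div, mul_div_assoc]
  refine mul_le_mul_of_nonneg_left ?_ hD
  rw [inv_mul_eq_div]
  gcongr
  linarith

/-- Global solutions of linear integral equations with bounded measurable coefficients. -/
lemma exists_linear_integral_solution {F : Type*} [NormedAddCommGroup F] [NormedSpace ℝ F]
    [CompleteSpace F] {B : ℝ → F →L[ℝ] F} (hB : StronglyMeasurable B) {C : ℝ}
    (hC : ∀ s, ‖B s‖ ≤ C) (x₀ : F) :
    ∃ X : ℝ → F, Continuous X ∧ ∀ t ≥ (0:ℝ), X t = x₀ + ∫ s in (0:ℝ)..t, B s (X s) := by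
  have hC0 : 0 ≤ C := (norm_nonneg _).trans (hC 0)
  set k : ℝ := 2 * C + 1 with hk
  have hk0 : 0 < k := by positivity
  have hint : ∀ m : BoundedContinuousFunction ℝ F, ∀ t : ℝ, 0 ≤ t →
      IntervalIntegrable (fun s => Real.exp (k * s) • B s (m s)) volume 0 t := by
    intro m t ht
    have := intervalIntegrable_clm_apply hB hC (x := fun s => Real.exp (k * s) • m s)
      (by fun_prop) le_rfl ht
    simpa using this
  have hbd : ∀ m : BoundedContinuousFunction ℝ F, ∀ s, ‖B s (m s)‖ ≤ C * ‖m‖ := fun m s =>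
    ((B s).le_opNorm _).trans (mul_le_mul (hC s) (m.norm_coe_le_norm s) (norm_nonneg _) hC0)
  have hcancel : ∀ t : ℝ, Real.exp (-(k * t)) * Real.exp (k * t) = 1 := fun t => by
    rw [← Real.exp_add]; simp
  let G : BoundedContinuousFunction ℝ F → ℝ → F := fun m t =>
    Real.exp (-(k * max t 0)) • (x₀ + ∫ s in (0:ℝ)..(max t 0), Real.exp (k * s) • B s (m s))
  have hGc : ∀ m, Continuous (G m) := by
    intro m
    have h1 : ContinuousOn (fun t : ℝ => ∫ s in (0:ℝ)..t, Real.exp (k * s) • B s (m s))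
        (Set.Ici 0) := by
      intro t ht
      have ht' : (0:ℝ) ≤ t + 1 := by have : (0:ℝ) ≤ t := ht; linarith
      have := intervalIntegral.continuousOn_primitive_interval
        (intervalIntegrable_iff_integrableOn_Icc_of_le ht' |>.1 (hint m _ ht')
          |> fun h => by rwa [← Set.uIcc_of_le ht'] at h)
      rw [Set.uIcc_of_le ht'] at this
      refine (this t ⟨ht, by linarith⟩).mono_of_mem_nhdsWithin ?_
      filter_upwards [self_mem_nhdsWithin, mem_nhdsWithin_of_mem_nhds
        (Iio_mem_nhds (show t < t + 1 by linarith))] with u hu hu'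
      exact ⟨hu, le_of_lt hu'⟩
    have h2 : Continuous fun t : ℝ =>
        ∫ s in (0:ℝ)..(max t 0), Real.exp (k * s) • B s (m s) :=
      h1.comp_continuous (f := fun t : ℝ => max t 0) (by fun_prop) fun t =>
      Set.mem_Ici.2 (le_max_right _ _)
    exact (by fun_prop : Continuous fun t : ℝ => Real.exp (-(k * max t 0))).smul
      (continuous_const.add h2)
  have hGb : ∀ m t, ‖G m t‖ ≤ ‖x₀‖ + C * ‖m‖ / k := by
    intro m t
    have h0 : (0:ℝ) ≤ max t 0 := le_max_right _ _
    have h1 := norm_integral_exp_smul_le hk0 h0 (hbd m)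
    have h2 : Real.exp (-(k * max t 0)) ≤ 1 := Real.exp_le_one_iff.2 (by
      have := mul_nonneg hk0.le h0; linarith)
    simp only [G]
    rw [norm_smul, Real.norm_eq_abs, Real.abs_exp]
    calc _ ≤ Real.exp (-(k * max t 0)) *
            (‖x₀‖ + C * ‖m‖ / k * Real.exp (k * max t 0)) := by
            gcongr
            exact (norm_add_le _ _).trans (by gcongr)
      _ = Real.exp (-(k * max t 0)) * ‖x₀‖ + C * ‖m‖ / k := by
            linear_combination (C * ‖m‖ / k) * hcancel (max t 0)
      _ ≤ _ := by
            gcongr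
            exact mul_le_of_le_one_left (norm_nonneg _) h2
  let Φ : BoundedContinuousFunction ℝ F → BoundedContinuousFunction ℝ F := fun m =>
    BoundedContinuousFunction.ofNormedAddCommGroup (G m) (hGc m) _ (hGb m)
  have hΦ : ContractingWith (1 / 2) Φ := by
    refine ⟨by rw [← NNReal.coe_lt_coe]; norm_num, LipschitzWith.of_dist_le_mul fun m m' => ?_⟩
    rw [BoundedContinuousFunction.dist_le (by positivity)]
    intro t
    have h0 : (0:ℝ) ≤ max t 0 := le_max_right _ _
    have h1 := norm_integral_exp_smul_le hk0 h0 (hbd (m - m'))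
    have h3 : G m t - G m' t = Real.exp (-(k * max t 0)) •
        ∫ s in (0:ℝ)..(max t 0), Real.exp (k * s) • B s ((m - m') s) := by
      simp only [G]
      rw [← smul_sub, add_sub_add_left_eq_sub,
        ← intervalIntegral.integral_sub (hint m _ h0) (hint m' _ h0)]
      simp [smul_sub]
    rw [dist_eq_norm]
    change ‖G m t - G m' t‖ ≤ _
    rw [h3, norm_smul, Real.norm_eq_abs, Real.abs_exp, dist_eq_norm]
    calc _ ≤ Real.exp (-(k * max t 0)) * (C * ‖m - m'‖ / k * Real.exp (k * max t 0)) := by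
            gcongr
      _ = C / k * ‖m - m'‖ := by
            linear_combination (C * ‖m - m'‖ / k) * hcancel (max t 0)
      _ ≤ _ := by
            gcongr
            rw [div_le_iff₀ hk0]
            push_cast
            linarith
  obtain ⟨m, hm⟩ : ∃ m, Φ m = m := ⟨_, hΦ.fixedPoint_isFixedPt⟩
  refine ⟨fun t => Real.exp (k * t) • m t, by fun_prop, fun t ht => ?_⟩
  have h1 : m t = G m t := by
    conv_lhs => rw [← hm]
    rfl
  have h2 : ∀ s, B s (Real.exp (k * s) • m s) = Real.exp (k * s) • B s (m s) := fun s =>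
    map_smul _ _ _
  simp only [h2]
  rw [h1]
  simp only [G]
  rw [max_eq_left ht, smul_smul, mul_comm, hcancel, one_smul]

/-- `x` is a solution on `[0, ∞)` of `x' = B x`, in integral form. -/
def SolvesLinear {F : Type*} [NormedAddCommGroup F] [NormedSpace ℝ F]
    (B : ℝ → F →L[ℝ] F) (x : ℝ → F) : Prop :=
  ContinuousOn x (Set.Ici 0) ∧ ∀ t ≥ (0:ℝ), x t = x 0 + ∫ s in (0:ℝ)..t, B s (x s)

section LinearEquation

variable {F : Type*} [NormedAddCommGroup F] [NormedSpace ℝ F]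
  {B : ℝ → F →L[ℝ] F} {C : ℝ} {x : ℝ → F}

lemma SolvesLinear.sub_eq (hx : SolvesLinear B x) (hB : StronglyMeasurable B)
    (hC : ∀ s, ‖B s‖ ≤ C) {a b : ℝ} (ha : 0 ≤ a) (hb : 0 ≤ b) :
    x b - x a = ∫ s in a..b, B s (x s) := by
  rw [hx.2 b hb, hx.2 a ha, add_sub_add_left_eq_sub, intervalIntegral.integral_interval_sub_left
    (intervalIntegrable_clm_apply hB hC hx.1 le_rfl hb)
    (intervalIntegrable_clm_apply hB hC hx.1 le_rfl ha)]

lemma SolvesLinear.exists_lipschitzOn (hx : SolvesLinear B x) (hB : StronglyMeasurable B)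
    (hC : ∀ s, ‖B s‖ ≤ C) {τ : ℝ} (hτ : 0 ≤ τ) :
    ∃ K : NNReal, LipschitzOnWith K x (Set.uIcc 0 τ) := by
  have hC0 : 0 ≤ C := (norm_nonneg _).trans (hC 0)
  have hsub : Set.uIcc 0 τ ⊆ Set.Ici 0 := fun s hs => (le_min le_rfl hτ).trans hs.1
  obtain ⟨D, hD⟩ := isCompact_uIcc.exists_bound_of_continuousOn (hx.1.mono hsub)
  have hD0 : 0 ≤ D := (norm_nonneg _).trans (hD 0 Set.left_mem_uIcc)
  refine ⟨⟨C * D, by positivity⟩, LipschitzOnWith.of_dist_le_mul fun a ha b hb => ?_⟩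
  rw [dist_eq_norm, hx.sub_eq hB hC (hsub hb) (hsub ha), dist_eq_norm, Real.norm_eq_abs]
  refine intervalIntegral.norm_integral_le_of_norm_le_const fun s hs => ?_
  refine ((B s).le_opNorm _).trans (mul_le_mul (hC s) (hD s ?_) (norm_nonneg _) hC0)
  exact Set.uIcc_subset_uIcc hb ha (Set.uIoc_subset_uIcc hs)

lemma SolvesLinear.ae_hasDerivAt [CompleteSpace F] (hx : SolvesLinear B x)
    (hB : StronglyMeasurable B) (hC : ∀ s, ‖B s‖ ≤ C) :
    ∀ᵐ t : ℝ, 0 < t → HasDerivAt x (B t (x t)) t := by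
  have h : ∀ᵐ t : ℝ, ∀ n : ℕ, t ∈ Set.uIcc (0:ℝ) n → ∀ c ∈ Set.uIcc (0:ℝ) n,
      HasDerivAt (fun u => ∫ s in c..u, B s (x s)) (B t (x t)) t :=
    ae_all_iff.2 fun n => (intervalIntegrable_clm_apply hB hC hx.1 le_rfl
      n.cast_nonneg).ae_hasDerivAt_integral
  filter_upwards [h] with t ht ht0
  obtain ⟨n, hn⟩ := exists_nat_gt t
  have h1 := (ht n (by rw [Set.uIcc_of_le n.cast_nonneg]; exact ⟨ht0.le, hn.le⟩) 0
    Set.left_mem_uIcc).const_add (x 0)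
  refine h1.congr_of_eventuallyEq ?_
  filter_upwards [Ioi_mem_nhds ht0] with u hu using hx.2 u (le_of_lt hu)

end LinearEquation

/-- The pairing between solutions of a linear equation and of its adjoint is constant. -/
lemma SolvesLinear.inner_eq {E : Type*} [NormedAddCommGroup E] [InnerProductSpace ℝ E]
    [CompleteSpace E] {B B' : ℝ → E →L[ℝ] E} {C : ℝ} {x l : ℝ → E}
    (hx : SolvesLinear B x) (hl : SolvesLinear B' l)
    (hB : StronglyMeasurable B) (hC : ∀ s, ‖B s‖ ≤ C)
    (hB' : StronglyMeasurable B') (hC' : ∀ s, ‖B' s‖ ≤ C)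
    (hadj : ∀ s y m, ⟪B' s m, y⟫ = -⟪m, B s y⟫) {t : ℝ} (ht : 0 ≤ t) :
    ⟪l t, x t⟫ = ⟪l 0, x 0⟫ := by
  have hsub : Set.uIcc 0 t ⊆ Set.Ici 0 := fun s hs => (le_min le_rfl ht).trans hs.1
  obtain ⟨K, hK⟩ := hx.exists_lipschitzOn hB hC ht
  obtain ⟨K', hK'⟩ := hl.exists_lipschitzOn hB' hC' ht
  obtain ⟨D, hD⟩ := isCompact_uIcc.exists_bound_of_continuousOn (hx.1.mono hsub)
  obtain ⟨D', hD'⟩ := isCompact_uIcc.exists_bound_of_continuousOn (hl.1.mono hsub)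
  have hD0 : 0 ≤ D := (norm_nonneg _).trans (hD 0 Set.left_mem_uIcc)
  have hD0' : 0 ≤ D' := (norm_nonneg _).trans (hD' 0 Set.left_mem_uIcc)
  lift D to NNReal using hD0
  lift D' to NNReal using hD0'
  have hlip : LipschitzOnWith (K' * D + D' * K) (fun s => ⟪l s, x s⟫)
      (Set.uIcc 0 t) := by
    refine LipschitzOnWith.of_dist_le_mul fun a ha b hb => ?_
    have h1 : ⟪l a, x a⟫ - ⟪l b, x b⟫ = ⟪l a - l b, x a⟫ + ⟪l b, x a - x b⟫ := by
      rw [inner_sub_left, inner_sub_right]; ring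
    have h2 := hK.dist_le_mul a ha b hb
    have h3 := hK'.dist_le_mul a ha b hb
    rw [dist_eq_norm] at h2 h3 ⊢
    rw [h1]
    calc _ ≤ ‖l a - l b‖ * ‖x a‖ + ‖l b‖ * ‖x a - x b‖ :=
          (norm_add_le _ _).trans (add_le_add (norm_inner_le_norm _ _) (norm_inner_le_norm _ _))
      _ ≤ (K' * dist a b) * D + D' * (K * dist a b) := by
          gcongr
          · exact hD a ha
          · exact hD' b hb
      _ = _ := by
          push_cast; ring
  obtain ⟨c, hc⟩ := hlip.absolutelyContinuousOnInterval.const_of_ae_hasDerivAt_zero (by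
    have h0 : ∀ᵐ s : ℝ, s ≠ 0 := by simp [ae_iff, measure_singleton]
    filter_upwards [hx.ae_hasDerivAt hB hC, hl.ae_hasDerivAt hB' hC', h0] with s h1 h2 h3 hs
    have hs0 : 0 < s := lt_of_le_of_ne (hsub hs) (Ne.symm h3)
    have := (h2 hs0).inner ℝ (h1 hs0)
    rwa [hadj, add_neg_cancel] at this)
  exact (hc t Set.right_mem_uIcc).trans (hc 0 Set.left_mem_uIcc).symm

/-- The fundamental solution of a linear equation. -/
lemma exists_fundamental_solution {F : Type*} [NormedAddCommGroup F] [NormedSpace ℝ F]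
    [CompleteSpace F] {B : ℝ → F →L[ℝ] F} (hB : StronglyMeasurable B) {C : ℝ}
    (hC : ∀ s, ‖B s‖ ≤ C) :
    ∃ Φ : ℝ → F →L[ℝ] F, Φ 0 = ContinuousLinearMap.id ℝ F ∧
      ∀ y, SolvesLinear B fun t => Φ t y := by
  let P := ContinuousLinearMap.compL ℝ F F F
  have hPB : StronglyMeasurable fun s => P (B s) := P.continuous.comp_stronglyMeasurable hB
  have hPC : ∀ s, ‖P (B s)‖ ≤ ‖P‖ * C := fun s =>
    (P.le_opNorm _).trans (mul_le_mul_of_nonneg_left (hC s) (norm_nonneg _))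
  obtain ⟨Φ, hΦc, hΦ⟩ := exists_linear_integral_solution hPB hPC (ContinuousLinearMap.id ℝ F)
  have h0 : Φ 0 = ContinuousLinearMap.id ℝ F := by simpa using hΦ 0 le_rfl
  refine ⟨Φ, h0, fun y => ⟨(hΦc.clm_apply continuous_const).continuousOn, fun t ht => ?_⟩⟩
  have h1 := congrArg (fun T : F →L[ℝ] F => T y) (hΦ t ht)
  simp only [_root_.add_apply] at h1
  change Φ t y = Φ 0 y + ∫ s in (0:ℝ)..t, B s (Φ s y)
  rw [h1, h0]
  congr 1
  exact ContinuousLinearMap.intervalIntegral_apply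
    (intervalIntegrable_clm_apply hPB hPC hΦc.continuousOn le_rfl ht) y

lemma stronglyMeasurable_toEuclideanCLM {n : ℕ} {A : ℝ → Matrix (Fin n) (Fin n) ℝ}
    (hA : ∀ i j, Measurable fun t => A t i j) :
    StronglyMeasurable fun t => Matrix.toEuclideanCLM (𝕜 := ℝ) (A t) := by
  have h : (fun t => Matrix.toEuclideanCLM (𝕜 := ℝ) (A t)) = fun t => ∑ i, ∑ j,
      A t i j • Matrix.toEuclideanCLM (𝕜 := ℝ) (Matrix.single i j (1:ℝ)) := by
    funext t
    conv_lhs => rw [Matrix.matrix_eq_sum_single (A t)]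
    simp only [map_sum, ← map_smul, Matrix.smul_single, smul_eq_mul, mul_one]
  rw [h]
  exact Finset.stronglyMeasurable_fun_sum _ fun i _ => Finset.stronglyMeasurable_fun_sum _
    fun j _ => (hA i j).stronglyMeasurable.smul_const _

lemma continuous_toEuclideanCLM (n : ℕ) : Continuous fun A : Matrix (Fin n) (Fin n) ℝ =>
    Matrix.toEuclideanCLM (𝕜 := ℝ) A :=
  LinearMap.continuous_of_finiteDimensional
    (Matrix.toEuclideanLin (𝕜 := ℝ) (m := Fin n) (n := Fin n) ≪≫ₗ
      LinearMap.toContinuousLinearMap).toLinearMap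

lemma IsCompact.exists_bound_toEuclideanCLM {n : ℕ} {M : Set (Matrix (Fin n) (Fin n) ℝ)}
    (hM : IsCompact M) : ∃ C, ∀ A ∈ M, ‖Matrix.toEuclideanCLM (𝕜 := ℝ) A‖ ≤ C :=
  hM.exists_bound_of_continuousOn (continuous_toEuclideanCLM n).continuousOn

lemma inner_mulE_transpose {n : ℕ} (A : Matrix (Fin n) (Fin n) ℝ) (l x : Vec n) :
    ⟪mulE Aᵀ l, x⟫ = ⟪l, mulE A x⟫ := by
  have h := Matrix.toEuclideanLin_conjTranspose_eq_adjoint A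
  rw [Matrix.conjTranspose_eq_transpose_of_trivial] at h
  rw [mulE, h, LinearMap.adjoint_inner_left, mulE]

section Norm

variable {n : ℕ} {v : Vec n → ℝ}

lemma IsNorm.nonneg (hv : IsNorm v) (x : Vec n) : 0 ≤ v x := by
  have h1 := hv.2.2 x (-x)
  have h2 := hv.2.1 (-1) x
  rw [add_neg_cancel, (hv.1 0).2 rfl] at h1
  simp only [neg_smul, one_smul, abs_neg, abs_one, one_mul] at h2
  linarith

lemma IsNorm.le_const_mul_norm (hv : IsNorm v) : ∃ K, 0 ≤ K ∧ ∀ x, v x ≤ K * ‖x‖ := by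
  have hnn := hv.nonneg
  obtain ⟨h0, hs, ha⟩ := hv
  have hsum : ∀ (s : Finset (Fin n)) (f : Fin n → Vec n), v (∑ i ∈ s, f i) ≤ ∑ i ∈ s, v (f i) :=
    fun s f => Finset.le_sum_of_subadditive v ((h0 0).2 rfl).le ha s f
  refine ⟨∑ i, v (EuclideanSpace.basisFun (Fin n) ℝ i),
    Finset.sum_nonneg fun i _ => hnn _, fun x => ?_⟩
  conv_lhs => rw [← (EuclideanSpace.basisFun (Fin n) ℝ).sum_repr x]
  refine (hsum _ _).trans ?_
  rw [Finset.sum_mul]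
  refine Finset.sum_le_sum fun i _ => ?_
  rw [hs, mul_comm]
  refine mul_le_mul_of_nonneg_left ?_ (hnn _)
  simpa using PiLp.norm_apply_le x i

lemma isClosed_subdiff (v : Vec n → ℝ) (x : Vec n) : IsClosed (subdiff v x) := by
  have : subdiff v x = {l | ⟪l, x⟫ = v x} ∩ ⋂ y, {l | ⟪l, y⟫ ≤ v y} := by
    ext l; simp [subdiff]
  rw [this]
  exact (isClosed_eq (by fun_prop) continuous_const).inter
    (isClosed_iInter fun y => isClosed_le (by fun_prop) continuous_const)

lemma IsNorm.isCompact_subdiff (hv : IsNorm v) (x : Vec n) : IsCompact (subdiff v x) := by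
  obtain ⟨K, hK0, hK⟩ := hv.le_const_mul_norm
  refine (isCompact_closedBall (0 : Vec n) K).of_isClosed_subset (isClosed_subdiff v x) ?_
  intro l hl
  rw [mem_closedBall_zero_iff]
  have h1 := (hl.2 l).trans (hK l)
  rw [real_inner_self_eq_norm_sq, sq] at h1
  by_contra! h2
  nlinarith

lemma IsNorm.subdiff_nonempty (hv : IsNorm v) (x : Vec n) : (subdiff v x).Nonempty := by
  obtain ⟨K, hK0, hK⟩ := hv.le_const_mul_norm
  have hnn := hv.nonneg
  obtain ⟨h0, hs, ha⟩ := hv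
  by_cases hx : x = 0
  · exact ⟨0, by simp [hx, (h0 0).2 rfl], fun y => by simpa using hnn y⟩
  obtain ⟨g, hg, hgv⟩ := exists_extension_of_le_sublinear
    (LinearPMap.mkSpanSingleton x (v x) hx) v
    (fun c hc y => by rw [hs, abs_of_pos hc]) ha (by
      rintro ⟨y, hy⟩
      obtain ⟨c, rfl⟩ := Submodule.mem_span_singleton.1 hy
      rw [LinearPMap.mkSpanSingleton'_apply, hs]
      exact mul_le_mul_of_nonneg_right (le_abs_self c) (hnn x))
  have hgx : g x = v x := by
    have h1 := hg ⟨x, Submodule.mem_span_singleton_self x⟩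
    rw [h1]
    exact LinearPMap.mkSpanSingleton_apply _ _ hx (v x)
  let l := (InnerProductSpace.toDual ℝ (Vec n)).symm (LinearMap.toContinuousLinearMap g)
  have hl : ∀ y, ⟪l, y⟫ = g y := fun y => by
    simp [l, InnerProductSpace.toDual_symm_apply]
  exact ⟨l, (hl x).trans hgx, fun y => (hl y).trans_le (hgv y)⟩

end Norm

section Extremal

variable {n : ℕ} {M : Set (Matrix (Fin n) (Fin n) ℝ)} {A : ℝ → Matrix (Fin n) (Fin n) ℝ}
  {x : ℝ → Vec n} {v : Vec n → ℝ}

lemma IsSolutionWith.solvesLinear (hx : IsSolutionWith M A x) :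
    SolvesLinear (fun t => Matrix.toEuclideanCLM (𝕜 := ℝ) (A t)) x :=
  ⟨hx.2.2.1, hx.2.2.2⟩

lemma IsSolutionWith.shift (hM : IsCompact M) (hx : IsSolutionWith M A x) {r : ℝ} (hr : 0 ≤ r) :
    IsSolutionWith M (fun t => A (t + r)) (fun t => x (t + r)) := by
  obtain ⟨C, hC⟩ := hM.exists_bound_toEuclideanCLM
  refine ⟨fun i j => (hx.1 i j).comp (measurable_id.add_const r), fun t => hx.2.1 _, ?_, ?_⟩
  · refine hx.2.2.1.comp (by fun_prop) fun t ht => ?_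
    exact add_nonneg ht hr
  · intro t ht
    have h := hx.solvesLinear.sub_eq (stronglyMeasurable_toEuclideanCLM hx.1)
      (fun s => hC _ (hx.2.1 s)) hr (add_nonneg ht hr)
    have h2 := intervalIntegral.integral_comp_add_right (a := 0) (b := t)
      (fun s => mulE (A s) (x s)) r
    simp only [zero_add] at h2 ⊢
    rw [h2, ← sub_eq_iff_eq_add']
    exact h

lemma IsExtremal.shift (hM : IsCompact M) (hx : IsExtremal M v x) {r : ℝ} (hr : 0 ≤ r) :
    IsExtremal M v (fun t => x (t + r)) := by
  obtain ⟨⟨A, hA⟩, hext⟩ := hx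
  refine ⟨⟨_, hA.shift hM hr⟩, fun t ht => ?_⟩
  show v (x (t + r)) = v (x (0 + r))
  rw [hext _ (add_nonneg ht hr), zero_add, hext r hr]

lemma IsBarabanov.le_of_le (hM : IsCompact M) (hv : IsBarabanov M v) (hx : IsSolutionWith M A x)
    {s t : ℝ} (hs : 0 ≤ s) (hst : s ≤ t) : v (x t) ≤ v (x s) := by
  have := hv.2.1 _ ⟨_, hx.shift hM hs⟩ (t - s) (sub_nonneg.2 hst)
  simpa using this

/-- Along an extremal solution, the adjoint flow pulls subgradients back to subgradients. -/
lemma exists_adjoint_flow (hM : IsCompact M) (hv : IsBarabanov M v) (hx : IsSolutionWith M A x)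
    (hext : ∀ t ≥ (0:ℝ), v (x t) = v (x 0)) :
    ∃ Y : ℝ → Vec n →L[ℝ] Vec n, (∀ l, Y 0 l = l) ∧ (∀ l, IsAdjointWith A fun t => Y t l) ∧
      (∀ t ≥ (0:ℝ), Function.Surjective (Y t)) ∧
      ∀ s t l, 0 ≤ s → s ≤ t → Y t l ∈ subdiff v (x t) → Y s l ∈ subdiff v (x s) := by
  obtain ⟨C, hC⟩ := hM.exists_bound_toEuclideanCLM
  have hA := stronglyMeasurable_toEuclideanCLM hx.1
  have hAC := fun s => hC _ (hx.2.1 s)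
  have hA' : StronglyMeasurable fun t => -Matrix.toEuclideanCLM (𝕜 := ℝ) (A t)ᵀ :=
    (stronglyMeasurable_toEuclideanCLM (A := fun t => (A t)ᵀ) fun i j => hx.1 j i).neg
  have hadj : ∀ s (y m : Vec n), ⟪(-Matrix.toEuclideanCLM (𝕜 := ℝ) (A s)ᵀ) m, y⟫
      = -⟪m, Matrix.toEuclideanCLM (𝕜 := ℝ) (A s) y⟫ := fun s y m => by
    rw [_root_.neg_apply, inner_neg_left]
    exact congrArg _ (inner_mulE_transpose (A s) m y)
  have hAC' : ∀ s, ‖-Matrix.toEuclideanCLM (𝕜 := ℝ) (A s)ᵀ‖ ≤ C := fun s => by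
    refine ContinuousLinearMap.opNorm_le_bound _ ((norm_nonneg _).trans (hAC 0)) fun m => ?_
    set w := (-Matrix.toEuclideanCLM (𝕜 := ℝ) (A s)ᵀ) m with hw
    have h1 : ‖w‖ * ‖w‖ ≤ C * ‖m‖ * ‖w‖ := by
      rw [← real_inner_self_eq_norm_mul_norm]
      conv_lhs => rw [hw, hadj]
      refine (neg_le_abs _).trans ((abs_real_inner_le_norm _ _).trans ?_)
      have h2 := ContinuousLinearMap.le_of_opNorm_le _ (hAC s) w
      calc _ ≤ ‖m‖ * (C * ‖w‖) := by gcongr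
        _ = _ := by ring
    rcases (norm_nonneg w).eq_or_lt with h | h
    · rw [← h]
      exact mul_nonneg ((norm_nonneg _).trans (hAC 0)) (norm_nonneg _)
    · exact le_of_mul_le_mul_right h1 h
  obtain ⟨Φ, hΦ0, hΦ⟩ := exists_fundamental_solution hA hAC
  obtain ⟨Y, hY0, hY⟩ := exists_fundamental_solution hA' hAC'
  have hpair : ∀ y l t, 0 ≤ t → ⟪Y t l, Φ t y⟫ = ⟪l, y⟫ := fun y l t ht => by
    have := (hΦ y).inner_eq (hY l) hA hAC hA' hAC' hadj ht
    simpa [hΦ0, hY0] using this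
  have hpx : ∀ l t, 0 ≤ t → ⟪Y t l, x t⟫ = ⟪l, x 0⟫ := fun l t ht => by
    have := hx.solvesLinear.inner_eq (hY l) hA hAC hA' hAC' hadj ht
    simpa [hY0] using this
  have hYsurj : ∀ t ≥ (0:ℝ), Function.Surjective (Y t) := fun t ht => by
    refine LinearMap.injective_iff_surjective (f := (Y t).toLinearMap).1
      ((injective_iff_map_eq_zero _).2 fun l hl => ?_)
    have hl' : Y t l = 0 := hl
    have := hpair l l t ht
    rw [hl', inner_zero_left] at this
    exact inner_self_eq_zero.1 this.symm
  have hΦsurj : ∀ t ≥ (0:ℝ), Function.Surjective (Φ t) := fun t ht => by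
    refine LinearMap.injective_iff_surjective (f := (Φ t).toLinearMap).1
      ((injective_iff_map_eq_zero _).2 fun l hl => ?_)
    have hl' : Φ t l = 0 := hl
    have := hpair l l t ht
    rw [hl', inner_zero_right] at this
    exact inner_self_eq_zero.1 this.symm
  refine ⟨Y, fun l => by simp [hY0], fun l => ⟨(hY l).1, fun t ht => ?_⟩, hYsurj, ?_⟩
  · have h := (hY l).2 t ht
    simp only [_root_.neg_apply, intervalIntegral.integral_neg] at h
    exact h.trans (sub_eq_add_neg _ _).symm
  · intro s t l hs hst hl
    have ht : 0 ≤ t := hs.trans hst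
    refine ⟨?_, fun y => ?_⟩
    · rw [hpx l s hs, ← hpx l t ht, hl.1, hext t ht, hext s hs]
    · obtain ⟨y, rfl⟩ := hΦsurj s hs y
      rw [hpair y l s hs, ← hpair y l t ht]
      exact (hl.2 _).trans (hv.le_of_le hM ⟨hx.1, hx.2.1, (hΦ y).1, (hΦ y).2⟩ hs hst)

/-- Every subgradient at a point of an extremal solution extends backwards to a continuous curve
of subgradients. -/
lemma exists_backward_subgradient (hM : IsCompact M) (hv : IsBarabanov M v)
    (hx : IsSolutionWith M A x) (hext : ∀ t ≥ (0:ℝ), v (x t) = v (x 0)) {τ : ℝ} (hτ : 0 ≤ τ)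
    {l : Vec n} (hl : l ∈ subdiff v (x τ)) :
    ∃ m : ℝ → Vec n, ContinuousOn m (Set.Ici 0) ∧ m τ = l ∧
      ∀ s, 0 ≤ s → s ≤ τ → m s ∈ subdiff v (x s) := by
  obtain ⟨Y, hY0, hY, hsurj, hpull⟩ := exists_adjoint_flow hM hv hx hext
  obtain ⟨l, rfl⟩ := hsurj τ hτ l
  exact ⟨fun t => Y t l, (hY l).1, rfl, fun s hs hsτ => hpull s τ l hs hsτ hl⟩

/-- Every extremal solution admits an adjoint solution consisting of subgradients. -/
lemma exists_forward_subgradient (hM : IsCompact M) (hv : IsBarabanov M v)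
    (hx : IsSolutionWith M A x) (hext : ∀ t ≥ (0:ℝ), v (x t) = v (x 0)) :
    ∃ m : ℝ → Vec n, IsAdjointWith A m ∧ ∀ t ≥ (0:ℝ), m t ∈ subdiff v (x t) := by
  obtain ⟨Y, hY0, hY, hsurj, hpull⟩ := exists_adjoint_flow hM hv hx hext
  obtain ⟨l, hl⟩ := IsCompact.nonempty_iInter_of_sequence_nonempty_isCompact_isClosed
    (fun k : ℕ => (Y k) ⁻¹' subdiff v (x k))
    (fun k l hl => hpull k (k + 1 : ℕ) l k.cast_nonneg (by simp) hl)
    (fun k => by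
      obtain ⟨l, hl⟩ := hv.1.subdiff_nonempty (x k)
      obtain ⟨m, rfl⟩ := hsurj k k.cast_nonneg l
      exact ⟨m, hl⟩)
    (by
      have : (Y (0 : ℕ)) ⁻¹' subdiff v (x (0 : ℕ)) = subdiff v (x 0) := by
        ext l; simp [hY0]
      rw [this]
      exact hv.1.isCompact_subdiff _)
    (fun k => (isClosed_subdiff v _).preimage (Y k).continuous)
  rw [Set.mem_iInter] at hl
  refine ⟨fun t => Y t l, hY l, fun t ht => ?_⟩
  obtain ⟨k, hk⟩ := exists_nat_ge t
  exact hpull t k l ht hk (hl k)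

lemma IsBarabanov.inner_mulE_nonpos (hv : IsBarabanov M v)
    {B : Matrix (Fin n) (Fin n) ℝ} (hB : B ∈ M) {y l : Vec n} (hl : l ∈ subdiff v y) :
    ⟪l, mulE B y⟫ ≤ 0 := by
  by_contra! hpos
  have hm : ∀ i j, Measurable fun _ : ℝ => B i j := fun i j => measurable_const
  obtain ⟨Φ, hΦ0, hΦ⟩ := exists_fundamental_solution
    (stronglyMeasurable_toEuclideanCLM (A := fun _ => B) hm) (fun _ => le_rfl)
  set ψ : ℝ → Vec n := fun t => Φ t y with hψ
  have hψ0 : ψ 0 = y := by simp [hψ, hΦ0]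
  have hsol : IsSolutionWith M (fun _ => B) ψ := ⟨hm, fun _ => hB, (hΦ y).1, (hΦ y).2⟩
  have hc : ContinuousOn (fun s => ⟪l, Matrix.toEuclideanCLM (𝕜 := ℝ) B (ψ s)⟫) (Set.Ici 0) :=
    continuousOn_const.inner ((ContinuousLinearMap.continuous _).comp_continuousOn (hΦ y).1)
  have hev : ∀ᶠ s in 𝓝[≥] (0:ℝ), 0 < ⟪l, Matrix.toEuclideanCLM (𝕜 := ℝ) B (ψ s)⟫ :=
    (hc 0 Set.self_mem_Ici).eventually (lt_mem_nhds (by simp only [hψ0]; exact hpos))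
  obtain ⟨δ, hδ, hδs⟩ := mem_nhdsGE_iff_exists_Ico_subset.1 hev
  have hδ0 : (0:ℝ) < δ := hδ
  have hint : IntervalIntegrable (fun s => Matrix.toEuclideanCLM (𝕜 := ℝ) B (ψ s)) volume 0 δ :=
    intervalIntegrable_clm_apply (B := fun _ => Matrix.toEuclideanCLM (𝕜 := ℝ) B)
      (stronglyMeasurable_toEuclideanCLM (A := fun _ => B) hm) (fun _ => le_rfl) (hΦ y).1
      le_rfl hδ0.le
  have h1 : 0 < ∫ s in (0:ℝ)..δ, ⟪l, Matrix.toEuclideanCLM (𝕜 := ℝ) B (ψ s)⟫ :=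
    intervalIntegral.intervalIntegral_pos_of_pos_on
      ((hc.mono (by rw [Set.uIcc_of_le hδ0.le]; exact fun s hs => hs.1)).intervalIntegrable)
      (fun s hs => hδs ⟨hs.1.le, hs.2⟩) hδ0
  have h2 : ∫ s in (0:ℝ)..δ, ⟪l, Matrix.toEuclideanCLM (𝕜 := ℝ) B (ψ s)⟫
      = ⟪l, ∫ s in (0:ℝ)..δ, Matrix.toEuclideanCLM (𝕜 := ℝ) B (ψ s)⟫ :=
    (innerSL ℝ l).intervalIntegral_comp_comm hint
  have h3 : ψ δ = ψ 0 + ∫ s in (0:ℝ)..δ, Matrix.toEuclideanCLM (𝕜 := ℝ) B (ψ s) :=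
    (hΦ y).2 δ hδ0.le
  have h4 := hv.2.1 ψ ⟨_, hsol⟩ δ hδ0.le
  have h5 := hl.2 (ψ δ)
  have h6 := hl.1
  rw [hψ0] at h3 h4
  rw [h3, inner_add_right] at h5
  rw [h3] at h4
  linarith

/-- The velocity of an extremal solution is almost everywhere orthogonal to all subgradients. -/
lemma ae_inner_velocity_eq_zero (hM : IsCompact M) (hx : IsSolutionWith M A x)
    (hext : ∀ t ≥ (0:ℝ), v (x t) = v (x 0)) :
    ∀ᵐ t : ℝ, 0 < t → ∀ l ∈ subdiff v (x t), ⟪l, mulE (A t) (x t)⟫ = 0 := by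
  obtain ⟨C, hC⟩ := hM.exists_bound_toEuclideanCLM
  filter_upwards [hx.solvesLinear.ae_hasDerivAt (stronglyMeasurable_toEuclideanCLM hx.1)
    (fun s => hC _ (hx.2.1 s))] with t ht ht0 l hl
  have h1 : HasDerivAt (fun s => ⟪l, x s⟫) ⟪l, mulE (A t) (x t)⟫ t := by
    have h := (hasDerivAt_const t l).inner ℝ (ht ht0)
    rw [inner_zero_left, add_zero] at h
    exact h
  refine IsLocalMax.hasDerivAt_eq_zero (f := fun s => ⟪l, x s⟫) ?_ h1
  filter_upwards [Ioi_mem_nhds ht0] with s hs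
  have h2 := hl.2 (x s)
  rw [hext s (le_of_lt hs), ← hext t ht0.le, ← hl.1] at h2
  exact h2

lemma maxCondWith_of_subdiff (hM : IsCompact M) (hv : IsBarabanov M v)
    (hx : IsSolutionWith M A x) (hext : ∀ t ≥ (0:ℝ), v (x t) = v (x 0)) {m : ℝ → Vec n}
    (hm : ∀ t ≥ (0:ℝ), m t ∈ subdiff v (x t)) : MaxCondWith M A x m := by
  rw [MaxCondWith, ← restrict_Ioi_eq_restrict_Ici, ae_restrict_iff' measurableSet_Ioi]
  filter_upwards [ae_inner_velocity_eq_zero hM hx hext] with t ht ht0 B hB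
  rw [ht ht0 _ (hm t (le_of_lt ht0))]
  exact hv.inner_mulE_nonpos hB (hm t (le_of_lt ht0))

/-- Under Condition G, extremal solutions starting at a common point with a single
subgradient coincide. -/
lemma ConditionG.eq_of_subsingleton_subdiff (hG : ConditionG M) (hM : IsCompact M)
    (hv : IsBarabanov M v) {x y : ℝ → Vec n} (hx : IsExtremal M v x) (hy : IsExtremal M v y)
    (hxy : x 0 = y 0) (hx0 : x 0 ≠ 0) (hs : (subdiff v (x 0)).Subsingleton) {t : ℝ}
    (ht : 0 ≤ t) : x t = y t := by
  obtain ⟨⟨A, hA⟩, hxe⟩ := hx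
  obtain ⟨⟨B, hB⟩, hye⟩ := hy
  obtain ⟨l, hl, hls⟩ := exists_forward_subgradient hM hv hA hxe
  obtain ⟨m, hm, hms⟩ := exists_forward_subgradient hM hv hB hye
  have hml : m 0 = l 0 := hs (hxy ▸ hms 0 le_rfl) (hls 0 le_rfl)
  have hl0 : l 0 ≠ 0 := fun h => by
    have h1 := (hls 0 le_rfl).1
    rw [h, inner_zero_left] at h1
    exact hx0 ((hv.1.1 _).1 h1.symm)
  exact (hG (x 0) (l 0) hx0 hl0 A B x y l m hA hB hl hm rfl hxy.symm rfl hml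
    (maxCondWith_of_subdiff hM hv hA hxe hls) (maxCondWith_of_subdiff hM hv hB hye hms) t ht).1

end Extremal

section Ridge

lemma mulE_combo {n : ℕ} (a b : ℝ) (A B : Matrix (Fin n) (Fin n) ℝ) (y : Vec n) :
    mulE (a • A + b • B) y = a • mulE A y + b • mulE B y := by
  simp [mulE]

lemma mulE_ne_zero {n : ℕ} {A : Matrix (Fin n) (Fin n) ℝ} (hA : IsUnit A) {y : Vec n}
    (hy : y ≠ 0) : mulE A y ≠ 0 := by
  intro h
  refine hy (WithLp.ofLp_injective 2 (Matrix.mulVec_injective_of_isUnit hA ?_))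
  rw [WithLp.ofLp_zero, Matrix.mulVec_zero]
  exact congrArg (WithLp.ofLp (p := 2)) h

/-- The common orthogonal complement of two independent vectors of `ℝ³` is a line. -/
lemma exists_orthogonal_direction {a b q : Vec 3} (hab : a ≠ b) (ha : ⟪a, q⟫ = 1)
    (hb : ⟪b, q⟫ = 1) : ∃ d : Vec 3, ∀ u, ⟪a, u⟫ = 0 → ⟪b, u⟫ = 0 → ⟪d, u⟫ = 0 → u = 0 := by
  have hli : LinearIndependent ℝ ![a, b] := by
    refine LinearIndependent.pair_iff.2 fun s t hst => ?_
    have h1 : s + t = 0 := by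
      have := congrArg (fun w => ⟪w, q⟫) hst
      simpa [inner_add_left, inner_smul_left, ha, hb] using this
    obtain rfl : t = -s := by linarith
    rw [neg_smul, ← sub_eq_add_neg, ← smul_sub, smul_eq_zero] at hst
    rcases hst with h | h
    · simp [h]
    · exact absurd (sub_eq_zero.1 h) hab
  have h2 : Module.finrank ℝ (Submodule.span ℝ (Set.range ![a, b])) = 2 := by
    simpa using finrank_span_eq_card hli
  have h3 := Submodule.finrank_add_finrank_orthogonal (Submodule.span ℝ (Set.range ![a, b]))
  rw [h2, finrank_euclideanSpace_fin] at h3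
  obtain ⟨⟨d, hd⟩, -, hspan⟩ := finrank_eq_one_iff'.1
    (show Module.finrank ℝ (Submodule.span ℝ (Set.range ![a, b]))ᗮ = 1 by omega)
  refine ⟨d, fun u hau hbu hdu => ?_⟩
  have hu : u ∈ (Submodule.span ℝ (Set.range ![a, b]))ᗮ := by
    rw [Submodule.mem_orthogonal]
    intro w hw
    induction hw using Submodule.span_induction with
    | mem w hw =>
      obtain ⟨i, rfl⟩ := hw
      fin_cases i
      · exact hau
      · exact hbu
    | zero => simp
    | add w w' _ _ h h' => rw [inner_add_left, h, h', add_zero]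
    | smul c w _ h => rw [inner_smul_left, h, mul_zero]
  obtain ⟨c, hc⟩ := hspan ⟨u, hu⟩
  have hc' : c • d = u := congrArg Subtype.val hc
  have h4 : ⟪u, u⟫ = 0 := by
    conv_lhs => rw [← hc', inner_smul_left, hc', hdu, mul_zero]
  exact inner_self_eq_zero.1 h4

/-- At a point with two distinct subgradients, all admissible velocities orthogonal to both of
them point in the same direction. -/
lemma exists_common_direction {M : Set (Matrix (Fin 3) (Fin 3) ℝ)} (hconv : Convex ℝ M)
    (hinv : ∀ A ∈ M, IsUnit A) {a b q : Vec 3} (hab : a ≠ b) (ha : ⟪a, q⟫ = 1)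
    (hb : ⟪b, q⟫ = 1) :
    ∃ d : Vec 3, (∀ u, ⟪a, u⟫ = 0 → ⟪b, u⟫ = 0 → ⟪d, u⟫ = 0 → u = 0) ∧
      ∀ B ∈ M, ⟪a, mulE B q⟫ = 0 → ⟪b, mulE B q⟫ = 0 → 0 < ⟪d, mulE B q⟫ := by
  obtain ⟨d, hd⟩ := exists_orthogonal_direction hab ha hb
  have hq : q ≠ 0 := by
    rintro rfl
    simp at ha
  have hne : ∀ B ∈ M, ⟪a, mulE B q⟫ = 0 → ⟪b, mulE B q⟫ = 0 → ⟪d, mulE B q⟫ ≠ 0 :=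
    fun B hB h1 h2 h3 => mulE_ne_zero (hinv B hB) hq (hd _ h1 h2 h3)
  by_cases hpos : ∀ B ∈ M, ⟪a, mulE B q⟫ = 0 → ⟪b, mulE B q⟫ = 0 → 0 < ⟪d, mulE B q⟫
  · exact ⟨d, hd, hpos⟩
  push Not at hpos
  obtain ⟨B₀, hB₀, ha₀, hb₀, hd₀⟩ := hpos
  replace hd₀ := lt_of_le_of_ne hd₀ (hne B₀ hB₀ ha₀ hb₀)
  refine ⟨-d, fun u h1 h2 h3 => hd u h1 h2 (by simpa using h3), fun B hB h1 h2 => ?_⟩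
  rw [inner_neg_left, Left.neg_pos_iff]
  by_contra! h3
  set g := ⟪d, mulE B q⟫ with hg
  set g₀ := ⟪d, mulE B₀ q⟫ with hg₀
  have hs : 0 < g - g₀ := by linarith
  have hmem : (g / (g - g₀)) • B₀ + (-g₀ / (g - g₀)) • B ∈ M :=
    hconv hB₀ hB (by positivity) (div_nonneg (by linarith) hs.le) (by field_simp; ring)
  refine hne _ hmem ?_ ?_ ?_
  · rw [mulE_combo, inner_add_right, inner_smul_right, inner_smul_right, ha₀, h1]; ring
  · rw [mulE_combo, inner_add_right, inner_smul_right, inner_smul_right, hb₀, h2]; ring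
  · rw [mulE_combo, inner_add_right, inner_smul_right, inner_smul_right, ← hg, ← hg₀]
    field_simp
    ring

/-- The positivity in `exists_common_direction` is uniform near the base point. -/
lemma exists_uniform_direction {n : ℕ} {M : Set (Matrix (Fin n) (Fin n) ℝ)} (hM : IsCompact M)
    {a b q d : Vec n}
    (hd : ∀ B ∈ M, ⟪a, mulE B q⟫ = 0 → ⟪b, mulE B q⟫ = 0 → 0 < ⟪d, mulE B q⟫) :
    ∃ c > (0:ℝ), ∀ᶠ P : Vec n × Vec n × Vec n in 𝓝 (q, a, b), ∀ B ∈ M,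
      ⟪P.2.1, mulE B P.1⟫ = 0 → ⟪P.2.2, mulE B P.1⟫ = 0 → c < ⟪d, mulE B P.1⟫ := by
  have hcont : Continuous fun w : (ℝ × Vec n × Vec n × Vec n) × Matrix (Fin n) (Fin n) ℝ =>
      mulE w.2 w.1.2.1 :=
    ((continuous_toEuclideanCLM n).comp continuous_snd).clm_apply (by fun_prop)
  have h := hM.eventually_forall_of_forall_eventually (x₀ := ((0:ℝ), q, a, b))
    (P := fun (w : ℝ × Vec n × Vec n × Vec n) (B : Matrix (Fin n) (Fin n) ℝ) =>
      ⟪w.2.2.1, mulE B w.2.1⟫ = 0 → ⟪w.2.2.2, mulE B w.2.1⟫ = 0 → w.1 < ⟪d, mulE B w.2.1⟫) (by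
    intro B hB
    by_cases h1 : ⟪a, mulE B q⟫ = 0
    · by_cases h2 : ⟪b, mulE B q⟫ = 0
      · have h3 := (isOpen_lt (f := fun w : (ℝ × Vec n × Vec n × Vec n) × _ => w.1.1)
          (by fun_prop) (continuous_const.inner (𝕜 := ℝ) (f := fun _ => d) hcont)).mem_nhds
          (x := (((0:ℝ), q, a, b), B)) (hd B hB h1 h2)
        filter_upwards [h3] with w hw _ _ using hw
      · have h3 : ∀ᶠ w in 𝓝 (((0:ℝ), q, a, b), B), ⟪w.1.2.2.2, mulE w.2 w.1.2.1⟫ ≠ 0 :=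
          (Continuous.inner (by fun_prop) hcont).continuousAt.eventually_ne h2
        filter_upwards [h3] with w hw _ h using absurd h hw
    · have h3 : ∀ᶠ w in 𝓝 (((0:ℝ), q, a, b), B), ⟪w.1.2.2.1, mulE w.2 w.1.2.1⟫ ≠ 0 :=
        (Continuous.inner (by fun_prop) hcont).continuousAt.eventually_ne h1
      filter_upwards [h3] with w hw h using absurd h hw)
  rw [nhds_prod_eq] at h
  have h' := h.curry.filter_mono (nhdsWithin_le_nhds (s := Set.Ioi (0:ℝ)))
  obtain ⟨c, hc, hc0⟩ := (h'.and self_mem_nhdsWithin).exists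
  exact ⟨c, hc0, hc⟩

lemma exists_ridge_arc {n : ℕ} {M : Set (Matrix (Fin n) (Fin n) ℝ)} (hM : IsCompact M)
    {v : Vec n → ℝ} (hv : IsBarabanov M v) {A : ℝ → Matrix (Fin n) (Fin n) ℝ} {x : ℝ → Vec n}
    (hx : IsSolutionWith M A x) (hext : ∀ t ≥ (0:ℝ), v (x t) = v (x 0)) {τ : ℝ} (hτ : 0 < τ)
    {a b d : Vec n} (ha : a ∈ subdiff v (x τ)) (hb : b ∈ subdiff v (x τ)) {c : ℝ} (hc : 0 < c)
    (hd : ∀ᶠ P : Vec n × Vec n × Vec n in 𝓝 (x τ, a, b), ∀ B ∈ M,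
      ⟪P.2.1, mulE B P.1⟫ = 0 → ⟪P.2.2, mulE B P.1⟫ = 0 → c < ⟪d, mulE B P.1⟫)
    {η : ℝ} (hη : 0 < η) :
    ∃ t₀, 0 ≤ t₀ ∧ t₀ < τ ∧ ⟪d, x t₀⟫ < ⟪d, x τ⟫ ∧ ∀ t ∈ Set.Icc t₀ τ,
      ∃ l ∈ subdiff v (x t), ∃ m ∈ subdiff v (x t), ‖l - a‖ < η ∧ ‖m - b‖ < η := by
  obtain ⟨C, hC⟩ := hM.exists_bound_toEuclideanCLM
  have hA := stronglyMeasurable_toEuclideanCLM hx.1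
  have hAC := fun s => hC _ (hx.2.1 s)
  obtain ⟨α, hαc, hα, hαs⟩ := exists_backward_subgradient hM hv hx hext hτ.le ha
  obtain ⟨β, hβc, hβ, hβs⟩ := exists_backward_subgradient hM hv hx hext hτ.le hb
  have hnhds := Ici_mem_nhds hτ
  have hxt := hx.2.2.1.continuousAt hnhds
  have hαt := hαc.continuousAt hnhds
  have hβt := hβc.continuousAt hnhds
  have hd' : ∀ᶠ P : Vec n × Vec n × Vec n in 𝓝 (x τ, α τ, β τ), ∀ B ∈ M,
      ⟪P.2.1, mulE B P.1⟫ = 0 → ⟪P.2.2, mulE B P.1⟫ = 0 → c < ⟪d, mulE B P.1⟫ := by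
    rw [hα, hβ]
    exact hd
  have hP := (hxt.prodMk (hαt.prodMk hβt)).eventually hd'
  have hαη : ∀ᶠ t in 𝓝 τ, ‖α t - a‖ < η := by
    have := hαt.eventually (Metric.ball_mem_nhds _ hη)
    simpa [hα, dist_eq_norm] using this
  have hβη : ∀ᶠ t in 𝓝 τ, ‖β t - b‖ < η := by
    have := hβt.eventually (Metric.ball_mem_nhds _ hη)
    simpa [hβ, dist_eq_norm] using this
  obtain ⟨ε, hε, hall⟩ := Metric.eventually_nhds_iff.1 (hP.and (hαη.and hβη))
  set t₀ := max (τ - ε / 2) (τ / 2) with ht₀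
  have h0 : 0 < t₀ := lt_max_of_lt_right (by linarith)
  have h1 : t₀ < τ := max_lt (by linarith) (by linarith)
  have hall' : ∀ t ∈ Set.Icc t₀ τ, dist t τ < ε := fun t ht => by
    have := (le_max_left (τ - ε / 2) (τ / 2)).trans ht.1
    rw [Real.dist_eq, abs_lt]
    constructor <;> linarith [ht.2]
  refine ⟨t₀, h0.le, h1, ?_, fun t ht => ⟨α t, hαs t (h0.le.trans ht.1) ht.2, β t,
    hβs t (h0.le.trans ht.1) ht.2, (hall (hall' t ht)).2⟩⟩
  have hint := intervalIntegrable_clm_apply hA hAC hx.2.2.1 h0.le hτ.le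
  have h2 := congrArg (fun w => ⟪d, w⟫) (hx.solvesLinear.sub_eq hA hAC h0.le hτ.le)
  simp only [inner_sub_right] at h2
  have h3 : ∫ s in t₀..τ, ⟪d, Matrix.toEuclideanCLM (𝕜 := ℝ) (A s) (x s)⟫
      = ⟪d, ∫ s in t₀..τ, Matrix.toEuclideanCLM (𝕜 := ℝ) (A s) (x s)⟫ :=
    (innerSL ℝ d).intervalIntegral_comp_comm hint
  have hint' : IntervalIntegrable
      (fun s => ⟪d, Matrix.toEuclideanCLM (𝕜 := ℝ) (A s) (x s)⟫) volume t₀ τ :=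
    ⟨(innerSL ℝ d).integrable_comp hint.1, (innerSL ℝ d).integrable_comp hint.2⟩
  have h4 : ∫ _ in t₀..τ, c ≤ ∫ s in t₀..τ, ⟪d, Matrix.toEuclideanCLM (𝕜 := ℝ) (A s) (x s)⟫ := by
    refine intervalIntegral.integral_mono_ae_restrict h1.le intervalIntegrable_const hint' ?_
    filter_upwards [ae_restrict_of_ae (ae_inner_velocity_eq_zero hM hx hext),
      ae_restrict_mem measurableSet_Icc] with s hs hsI
    have hs0 := h0.trans_le hsI.1
    exact ((hall (hall' s hsI)).1 (A s) (hx.2.1 s)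
      (hs hs0 _ (hαs s hs0.le hsI.2)) (hs hs0 _ (hβs s hs0.le hsI.2))).le
  rw [intervalIntegral.integral_const, smul_eq_mul] at h4
  have h5 : 0 < (τ - t₀) * c := mul_pos (sub_pos.2 h1) hc
  linarith

/-- Two extremal arcs on the unit sphere which arrive at a common point with several
subgradients meet before reaching it. -/
lemma exists_earlier_intersection {M : Set (Matrix (Fin 3) (Fin 3) ℝ)} (hM : IsCompact M)
    (hconv : Convex ℝ M) (hinv : ∀ A ∈ M, IsUnit A) {v : Vec 3 → ℝ} (hv : IsBarabanov M v)
    {x y : ℝ → Vec 3} (hx : IsExtremal M v x) (hy : IsExtremal M v y) {τ σ : ℝ} (hτ : 0 < τ)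
    (hσ : 0 < σ) (hxy : x τ = y σ) (hv1 : v (x τ) = 1) (hns : ¬ (subdiff v (x τ)).Subsingleton) :
    ∃ t s, 0 ≤ t ∧ t < τ ∧ 0 ≤ s ∧ x t = y s := by
  obtain ⟨⟨A, hA⟩, hxe⟩ := hx
  obtain ⟨⟨B, hB⟩, hye⟩ := hy
  obtain ⟨a, ha, b, hb, hab⟩ := Set.not_subsingleton_iff.1 hns
  obtain ⟨d, hd, hdpos⟩ := exists_common_direction hconv hinv hab (ha.1.trans hv1)
    (hb.1.trans hv1)
  obtain ⟨c, hc, hev⟩ := exists_uniform_direction hM hdpos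
  let L : Vec 3 →L[ℝ] ℝ × ℝ × ℝ :=
    (innerSL ℝ a).prod ((innerSL ℝ b).prod (innerSL ℝ d))
  have hL : ∀ u, L u = (⟪a, u⟫, ⟪b, u⟫, ⟪d, u⟫) := fun u => rfl
  obtain ⟨K, hK0, hK⟩ := (L : Vec 3 →ₗ[ℝ] ℝ × ℝ × ℝ).exists_antilipschitzWith
    (LinearMap.ker_eq_bot'.2 fun u hu => by
      have h : (⟪a, u⟫, ⟪b, u⟫, ⟪d, u⟫) = (0 : ℝ × ℝ × ℝ) := hu
      simp only [Prod.mk_eq_zero] at h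
      exact hd u h.1 h.2.1 h.2.2)
  have hK0' : (0:ℝ) < K := hK0
  have hη : (0:ℝ) < 1 / (2 * K) := by positivity
  obtain ⟨t₀, ht₀, ht₀τ, hlt, harc⟩ := exists_ridge_arc hM hv hA hxe hτ ha hb hc hev hη
  obtain ⟨s₀, hs₀, hs₀σ, hlt', harc'⟩ := exists_ridge_arc hM hv hB hye hσ (hxy ▸ ha) (hxy ▸ hb)
    hc (hxy ▸ hev) hη
  have hcx : ContinuousOn (fun t => ⟪d, x t⟫) (Set.Icc t₀ τ) :=
    continuousOn_const.inner (hA.2.2.1.mono fun t ht => ht₀.trans ht.1)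
  have hcy : ContinuousOn (fun t => ⟪d, y t⟫) (Set.Icc s₀ σ) :=
    continuousOn_const.inner (hB.2.2.1.mono fun t ht => hs₀.trans ht.1)
  rw [← hxy] at hlt'
  obtain ⟨t, ht, hte⟩ := intermediate_value_Icc ht₀τ.le hcx
    (show max ⟪d, x t₀⟫ ⟪d, y s₀⟫ ∈ _ from ⟨le_max_left _ _, (max_lt hlt hlt').le⟩)
  obtain ⟨s, hs, hse⟩ := intermediate_value_Icc hs₀σ.le hcy
    (show max ⟪d, x t₀⟫ ⟪d, y s₀⟫ ∈ _ from
      ⟨le_max_right _ _, by rw [← hxy]; exact (max_lt hlt hlt').le⟩)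
  have ht0 := ht₀.trans ht.1
  have hs0 := hs₀.trans hs.1
  have htτ : t < τ := lt_of_le_of_ne ht.2 fun h => by
    rw [h] at hte
    exact (max_lt hlt hlt').ne' hte
  refine ⟨t, s, ht0, htτ, hs0, sub_eq_zero.1 ?_⟩
  obtain ⟨l, hl, m, hm, hla, hmb⟩ := harc t ht
  obtain ⟨l', hl', m', hm', hla', hmb'⟩ := harc' s hs
  have hvxy : v (x t) = v (y s) := by
    rw [hxe t ht0, ← hxe τ hτ.le, hye s hs0, ← hye σ hσ.le, hxy]
  set u := x t - y s with hu
  have hsmall : ∀ {e g : Vec 3}, ‖g - e‖ < 1 / (2 * K) → |⟪g, u⟫ - ⟪e, u⟫| ≤ 1 / (2 * K) * ‖u‖ :=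
    fun {e g} h => by
      rw [← inner_sub_left]
      exact (abs_real_inner_le_norm _ _).trans (by gcongr)
  have hnn : ∀ g ∈ subdiff v (x t), 0 ≤ ⟪g, u⟫ := fun g hg => by
    have := hg.2 (y s)
    rw [hu, inner_sub_right, hg.1, hvxy]
    linarith
  have hnp : ∀ g ∈ subdiff v (y s), ⟪g, u⟫ ≤ 0 := fun g hg => by
    have := hg.2 (x t)
    rw [hu, inner_sub_right, hg.1, ← hvxy]
    linarith
  have hau : |⟪a, u⟫| ≤ 1 / (2 * K) * ‖u‖ := by
    have h1 := abs_le.1 (hsmall hla)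
    have h2 := abs_le.1 (hsmall hla')
    rw [abs_le]
    constructor <;> linarith [hnn l hl, hnp l' hl', h1.1, h1.2, h2.1, h2.2]
  have hbu : |⟪b, u⟫| ≤ 1 / (2 * K) * ‖u‖ := by
    have h1 := abs_le.1 (hsmall hmb)
    have h2 := abs_le.1 (hsmall hmb')
    rw [abs_le]
    constructor <;> linarith [hnn m hm, hnp m' hm', h1.1, h1.2, h2.1, h2.2]
  have hdu : ⟪d, u⟫ = 0 := by
    rw [hu, inner_sub_right, sub_eq_zero]
    exact hte.trans hse.symm
  have hLu : ‖L u‖ ≤ 1 / (2 * K) * ‖u‖ := by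
    rw [hL, Prod.norm_def, Prod.norm_def, hdu]
    simp only [Real.norm_eq_abs, abs_zero]
    exact max_le hau (max_le hbu (by positivity))
  have hKu : ‖u‖ ≤ K * ‖L u‖ := by
    have := hK.le_mul_dist u 0
    simpa using this
  have hfin : ‖u‖ ≤ 1 / 2 * ‖u‖ := by
    calc ‖u‖ ≤ K * (1 / (2 * K) * ‖u‖) := hKu.trans (by gcongr)
      _ = 1 / 2 * ‖u‖ := by field_simp
  exact norm_eq_zero.1 (by linarith [norm_nonneg u])

end Ridge

lemma image_Ici_eq_image_Icc_of_periodic {X : Type*} {p : ℝ → X} {T : ℝ} (hT : 0 < T)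
    (hper : ∀ t ≥ (0:ℝ), p (t + T) = p t) : p '' Set.Ici 0 = p '' Set.Icc 0 T := by
  refine Set.Subset.antisymm ?_ (Set.image_mono fun t ht => ht.1)
  rintro _ ⟨t, ht, rfl⟩
  have hn : ∀ (k : ℕ) (s : ℝ), 0 ≤ s → p (s + k * T) = p s := by
    intro k
    induction k with
    | zero => simp
    | succ k ih =>
      intro s hs
      rw [← ih s hs, ← hper (s + k * T) (by positivity)]
      congr 1
      push_cast
      ring
  have ht0 : (0:ℝ) ≤ t / T := div_nonneg ht hT.le
  have h1 := (le_div_iff₀ hT).1 (Nat.floor_le ht0)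
  have h2 := (div_lt_iff₀ hT).1 (Nat.lt_floor_add_one (t / T))
  refine ⟨t - ⌊t / T⌋₊ * T, ⟨by linarith, by linarith⟩, ?_⟩
  rw [← hn ⌊t / T⌋₊ _ (by linarith), sub_add_cancel]

theorem stmt6 (M : Set (Matrix (Fin 3) (Fin 3) ℝ))
    (hne : M.Nonempty) (hcpt : IsCompact M) (hconv : Convex ℝ M)
    (hirr : MIrreducible M) (hrho : rhoZero M) (hinv : ∀ A ∈ M, IsUnit A)
    (hG : ConditionG M)
    (v : Vec 3 → ℝ) (hv : IsBarabanov M v)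
    (p : ℝ → Vec 3) (T : ℝ) (hT : 0 < T) (hp : IsExtremal M v p)
    (hper : ∀ t ≥ (0:ℝ), p (t + T) = p t)
    (Γ : Set (Vec 3)) (hΓ : Γ = p '' Set.Ici 0) (hΓS : Γ ⊆ {x | v x = 1})
    (S₁ : Set (Vec 3)) (w : Vec 3) (hw : w ∈ {x | v x = 1} \ Γ)
    (hS₁ : S₁ = connectedComponentIn ({x | v x = 1} \ Γ) w)
    (z : ℝ → Vec 3) (hz : IsExtremal M v z) (hz0 : z 0 ∈ S₁) :
    (∀ t ≥ (0:ℝ), z t ∈ S₁ ∪ Γ) ∧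
      ∀ tstar ≥ (0:ℝ), z tstar ∈ Γ → ∀ t ≥ tstar, z t ∈ Γ := by
  have hzc : ContinuousOn z (Set.Ici 0) := hz.1.choose_spec.2.2.1
  have hpc : ContinuousOn p (Set.Ici 0) := hp.1.choose_spec.2.2.1
  have hsub : S₁ ⊆ {x | v x = 1} \ Γ := hS₁ ▸ connectedComponentIn_subset _ _
  have hz1 : ∀ t ≥ (0:ℝ), v (z t) = 1 := fun t ht => (hz.2 t ht).trans (hsub hz0).1
  have hΓ' : Γ = p '' Set.Icc 0 T := hΓ.trans (image_Ici_eq_image_Icc_of_periodic hT hper)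
  have hΓcl : IsClosed Γ := hΓ' ▸
    (isCompact_Icc.image_of_continuousOn (hpc.mono fun t ht => ht.1)).isClosed
  have hstay : ∀ tstar ≥ (0:ℝ), z tstar ∈ Γ → ∀ t ≥ tstar, z t ∈ Γ := by
    intro tstar hts hmem t ht
    have hK : IsCompact (Set.Icc 0 tstar ∩ z ⁻¹' Γ) :=
      isCompact_Icc.of_isClosed_subset ((hzc.mono fun t ht => ht.1).preimage_isClosed_of_isClosed
        isClosed_Icc hΓcl) Set.inter_subset_left
    obtain ⟨τ, ⟨⟨hτ0, hτs⟩, hτΓ⟩, hleast⟩ := hK.exists_isLeast ⟨tstar, ⟨hts, le_rfl⟩, hmem⟩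
    have hτpos : 0 < τ := lt_of_le_of_ne hτ0 fun h => (hsub hz0).2 (by rw [h]; exact hτΓ)
    obtain ⟨σ, hσ0, hσ⟩ : ∃ σ, 0 < σ ∧ z τ = p σ := by
      have h : z τ ∈ p '' Set.Ici 0 := hΓ ▸ hτΓ
      obtain ⟨s, hs, hsz⟩ := h
      exact ⟨s + T, add_pos_of_nonneg_of_pos hs hT, by rw [hper s hs, hsz]⟩
    by_cases hsing : (subdiff v (z τ)).Subsingleton
    · have hτt : 0 ≤ t - τ := sub_nonneg.2 (hτs.trans ht)
      have h := hG.eq_of_subsingleton_subdiff hcpt hv (hz.shift hcpt hτ0) (hp.shift hcpt hσ0.le)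
        (by simpa using hσ) (by
          intro h
          have h1 := hz1 τ hτ0
          rw [zero_add] at h
          rw [h, (hv.1.1 0).2 rfl] at h1
          exact zero_ne_one h1) (by simpa using hsing) hτt
      rw [sub_add_cancel] at h
      rw [h, hΓ]
      exact ⟨_, add_nonneg hτt hσ0.le, rfl⟩
    · obtain ⟨r, s, hr0, hrτ, hs0, hrs⟩ := exists_earlier_intersection hcpt hconv hinv hv hz hp
        hτpos hσ0 hσ (hz1 τ hτ0) hsing
      have hrΓ : z r ∈ Γ := by
        rw [hrs, hΓ]
        exact ⟨s, hs0, rfl⟩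
      exact absurd (hleast ⟨⟨hr0, hrτ.le.trans hτs⟩, hrΓ⟩) (not_le.2 hrτ)
  refine ⟨fun t ht => ?_, hstay⟩
  by_cases hzt : z t ∈ Γ
  · exact Or.inr hzt
  · left
    have hpre : IsPreconnected (z '' Set.Icc 0 t) :=
      isPreconnected_Icc.image _ (hzc.mono fun s hs => hs.1)
    have hss : z '' Set.Icc 0 t ⊆ {x | v x = 1} \ Γ := by
      rintro _ ⟨s, hs, rfl⟩
      exact ⟨hz1 s hs.1, fun h => hzt (hstay s hs.1 h t hs.2)⟩
    have hz0' : z 0 ∈ connectedComponentIn ({x | v x = 1} \ Γ) w := hS₁ ▸ hz0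
    rw [hS₁, connectedComponentIn_eq hz0']
    exact hpre.subset_connectedComponentIn ⟨0, ⟨le_rfl, ht⟩, rfl⟩ hss ⟨t, ⟨ht, le_rfl⟩, rfl⟩
end
end

section
/- Let v be a Barabanov norm with unit sphere S, and let Ω := ⋃ ω(x(·)), the union being over all v-extremal solutions x with v(x(t)) = 1 for all t ≥ 0. Assume there exists a dense subset Ω̂ of Ω such that for every z₁, z₂ ∈ Ω̂ there exist an integer N > 0 and v-extremal solutions x₁, …, x_N on S with z₁ ∈ ω(x₁(·)), z₂ ∈ ω(x_N(·)), and ω(xᵢ(·)) ∩ ω(xᵢ₊₁(·)) ≠ ∅ for i = 1, …, N−1. Then the Barabanov norm is unique up to homogeneity: for every Barabanov norm w there exists λ > 0 with w = λ·v. -/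
open MeasureTheory Filter Topology RealInnerProductSpace Matrix

noncomputable section

def OmegaUnion {n : ℕ} (M : Set (Matrix (Fin n) (Fin n) ℝ)) (v : Vec n → ℝ) :
    Set (Vec n) :=
  ⋃ x ∈ {x : ℝ → Vec n | IsSolution M x ∧ ∀ t ≥ (0:ℝ), v (x t) = 1}, omegaLimitSet x

namespace IsNorm

variable {n : ℕ} {v : Vec n → ℝ}

theorem map_zero (hv : IsNorm v) : v 0 = 0 := (hv.1 0).2 rfl

theorem nonneg_s7 (hv : IsNorm v) (x : Vec n) : 0 ≤ v x := by
  have h := hv.2.2 x ((-1 : ℝ) • x)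
  rw [hv.2.1] at h
  simp only [neg_smul, one_smul, add_neg_cancel, hv.map_zero, abs_neg, abs_one] at h
  linarith

theorem pos (hv : IsNorm v) {x : Vec n} (hx : x ≠ 0) : 0 < v x :=
  lt_of_le_of_ne (hv.nonneg_s7 x) fun h => hx ((hv.1 x).1 h.symm)

theorem continuous (hv : IsNorm v) : Continuous v := by
  have hc : ConvexOn ℝ Set.univ v := by
    refine ⟨convex_univ, fun x _ y _ a b ha hb _ => ?_⟩
    have h := hv.2.2 (a • x) (b • y)
    rwa [hv.2.1, hv.2.1, abs_of_nonneg ha, abs_of_nonneg hb] at h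
  exact continuousOn_univ.1 (hc.continuousOn isOpen_univ)

theorem map_inv_smul_self (hv : IsNorm v) {x : Vec n} (hx : x ≠ 0) : v ((v x)⁻¹ • x) = 1 := by
  have h := hv.pos hx
  rw [hv.2.1, abs_of_pos (inv_pos.2 h), inv_mul_cancel₀ h.ne']

theorem isCompact_sphere (hv : IsNorm v) : IsCompact {x | v x = 1} := by
  rcases (Metric.sphere (0 : Vec n) 1).eq_empty_or_nonempty with he | hne
  · have : {x : Vec n | v x = 1} = ∅ := by
      refine Set.eq_empty_of_forall_notMem fun x (hx : v x = 1) => ?_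
      have hx0 : x ≠ 0 := by
        rintro rfl
        simp [hv.map_zero] at hx
      refine Set.notMem_empty (‖x‖⁻¹ • x) (he ▸ ?_)
      simp [norm_smul, hx0]
    rw [this]
    exact isCompact_empty
  obtain ⟨u, hu, hmin⟩ :=
    (_root_.isCompact_sphere (0 : Vec n) 1).exists_isMinOn hne hv.continuous.continuousOn
  have hu0 : u ≠ 0 := by
    rintro rfl
    simp at hu
  have hpos := hv.pos hu0
  refine Metric.isCompact_of_isClosed_isBounded
    (isClosed_eq hv.continuous continuous_const) ?_
  refine (Metric.isBounded_closedBall (x := (0 : Vec n)) (r := (v u)⁻¹)).subset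
    fun x (hx : v x = 1) => ?_
  have hx0 : x ≠ 0 := by
    rintro rfl
    simp [hv.map_zero] at hx
  have hnx : 0 < ‖x‖ := norm_pos_iff.2 hx0
  have hle : v u ≤ v (‖x‖⁻¹ • x) := by
    refine hmin ?_
    simp [norm_smul, hx0]
  rw [hv.2.1, abs_of_pos (inv_pos.2 hnx), hx, mul_one] at hle
  rw [mem_closedBall_zero_iff]
  exact (le_inv_comm₀ hpos hnx).1 hle

end IsNorm

section Solutions

variable {n : ℕ} {M : Set (Matrix (Fin n) (Fin n) ℝ)}

theorem mulE_eq_sum (A : Matrix (Fin n) (Fin n) ℝ) (y : Vec n) :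
    mulE A y = ∑ i, ∑ j, (A i j * y j) • EuclideanSpace.single i (1 : ℝ) := by
  ext k
  simp [mulE, Matrix.mulVec, dotProduct, Finset.sum_apply, Pi.single_apply]

theorem IsCompact.exists_entry_bound (hM : IsCompact M) (i j : Fin n) :
    ∃ C : ℝ, ∀ A ∈ M, ‖A i j‖ ≤ C :=
  hM.exists_bound_of_continuousOn (f := fun A : Matrix (Fin n) (Fin n) ℝ => A i j)
    (by fun_prop)

theorem IsSolutionWith.intervalIntegrable (hM : IsCompact M)
    {A : ℝ → Matrix (Fin n) (Fin n) ℝ} {x : ℝ → Vec n} (h : IsSolutionWith M A x)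
    {a b : ℝ} (ha : 0 ≤ a) (hb : 0 ≤ b) :
    IntervalIntegrable (fun s => mulE (A s) (x s)) volume a b := by
  obtain ⟨hm, hA, hx, -⟩ := h
  have hsub : Set.uIcc a b ⊆ Set.Ici 0 := fun t ht => (le_min ha hb).trans ht.1
  have hAi : ∀ i j, IntervalIntegrable (fun s => A s i j) volume a b := fun i j => by
    obtain ⟨C, hC⟩ := hM.exists_entry_bound i j
    exact (intervalIntegrable_const (c := C)).mono_fun (hm i j).aestronglyMeasurable
      (Eventually.of_forall fun s => (hC _ (hA s)).trans (le_abs_self C))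
  simp only [mulE_eq_sum]
  have hij : ∀ i j : Fin n, IntervalIntegrable
      (fun s => (A s i j * x s j) • EuclideanSpace.single i (1 : ℝ)) volume a b := fun i j => by
    have hxj : ContinuousOn (fun s => x s j) (Set.uIcc a b) := by
      have hx' := hx.mono hsub
      fun_prop
    exact ((hAi i j).mul_continuousOn hxj).smul_continuousOn continuousOn_const
  have h := IntervalIntegrable.sum Finset.univ
    (f := fun i s => ∑ j, (A s i j * x s j) • EuclideanSpace.single i (1 : ℝ))
    fun i _ => by
      have := IntervalIntegrable.sum Finset.univ
        (f := fun j s => (A s i j * x s j) • EuclideanSpace.single i (1 : ℝ))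
        fun j _ => hij i j
      simpa only [Finset.sum_fn] using this
  simpa only [Finset.sum_fn] using h

theorem IsSolution.shift (hM : IsCompact M) {x : ℝ → Vec n} (h : IsSolution M x)
    {s : ℝ} (hs : 0 ≤ s) : IsSolution M fun t => x (t + s) := by
  obtain ⟨A, hA⟩ := h
  have hA' := hA
  obtain ⟨hm, hAM, hx, hint⟩ := hA'
  refine ⟨fun t => A (t + s), fun i j => (hm i j).comp (measurable_add_const s),
    fun t => hAM _, ?_, fun t ht => ?_⟩
  · exact hx.comp (by fun_prop) fun t ht => add_nonneg ht hs
  · have hts : 0 ≤ t + s := add_nonneg ht hs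
    change x (t + s) = x (0 + s) + ∫ r in (0 : ℝ)..t, mulE (A (r + s)) (x (r + s))
    rw [intervalIntegral.integral_comp_add_right (fun r => mulE (A r) (x r)), zero_add,
      hint _ hts, hint s hs, add_assoc,
      intervalIntegral.integral_add_adjacent_intervals
        (hA.intervalIntegrable hM le_rfl hs) (hA.intervalIntegrable hM hs hts)]

theorem IsBarabanov.antitoneOn {w : Vec n → ℝ} (hw : IsBarabanov M w) (hM : IsCompact M)
    {x : ℝ → Vec n} (hx : IsSolution M x) {s t : ℝ} (hs : 0 ≤ s) (hst : s ≤ t) :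
    w (x t) ≤ w (x s) := by
  simpa using hw.2.1 _ (hx.shift hM hs) (t - s) (sub_nonneg.2 hst)

theorem IsBarabanov.le_of_mem_omegaLimitSet {w : Vec n → ℝ} (hw : IsBarabanov M w)
    (hM : IsCompact M) {x : ℝ → Vec n} (hx : IsSolution M x) {p : Vec n}
    (hp : p ∈ omegaLimitSet x) {s : ℝ} (hs : 0 ≤ s) : w p ≤ w (x s) := by
  obtain ⟨tk, htk, hlim⟩ := hp
  refine le_of_tendsto ((hw.1.continuous.tendsto p).comp hlim) ?_
  filter_upwards [htk.eventually_ge_atTop s] with k hk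
  exact hw.antitoneOn hM hx hs hk

theorem IsBarabanov.eq_of_mem_omegaLimitSet {w : Vec n → ℝ} (hw : IsBarabanov M w)
    (hM : IsCompact M) {x : ℝ → Vec n} (hx : IsSolution M x) {p q : Vec n}
    (hp : p ∈ omegaLimitSet x) (hq : q ∈ omegaLimitSet x) : w p = w q := by
  have key : ∀ {p q : Vec n}, p ∈ omegaLimitSet x → q ∈ omegaLimitSet x → w p ≤ w q := by
    intro p q hp hq
    obtain ⟨tk, htk, hlim⟩ := hq
    refine ge_of_tendsto ((hw.1.continuous.tendsto q).comp hlim) ?_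
    filter_upwards [htk.eventually_ge_atTop 0] with k hk
    exact hw.le_of_mem_omegaLimitSet hM hx hp hk
  exact le_antisymm (key hp hq) (key hq hp)

theorem omegaLimitSet_nonempty {K : Set (Vec n)} (hK : IsCompact K) {x : ℝ → Vec n}
    (hx : ∀ t ≥ (0 : ℝ), x t ∈ K) : (omegaLimitSet x).Nonempty := by
  obtain ⟨p, -, φ, hφ, hlim⟩ := hK.tendsto_subseq (x := fun k : ℕ => x k)
    fun k => hx k k.cast_nonneg
  exact ⟨p, fun k => (φ k : ℝ), tendsto_natCast_atTop_atTop.comp hφ.tendsto_atTop, hlim⟩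

end Solutions

theorem stmt7 (n : ℕ) (hn : 0 < n) (M : Set (Matrix (Fin n) (Fin n) ℝ))
    (hne : M.Nonempty) (hcpt : IsCompact M) (hconv : Convex ℝ M)
    (v : Vec n → ℝ) (hv : IsBarabanov M v)
    (Ωh : Set (Vec n)) (hsub : Ωh ⊆ OmegaUnion M v)
    (hdense : OmegaUnion M v ⊆ closure Ωh)
    (hchain : ∀ z₁ ∈ Ωh, ∀ z₂ ∈ Ωh, ∃ N : ℕ, 0 < N ∧ ∃ xs : ℕ → ℝ → Vec n,
      (∀ i < N, IsSolution M (xs i) ∧ ∀ t ≥ (0:ℝ), v (xs i t) = 1) ∧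
      z₁ ∈ omegaLimitSet (xs 0) ∧ z₂ ∈ omegaLimitSet (xs (N - 1)) ∧
      ∀ i, i + 1 < N → (omegaLimitSet (xs i) ∩ omegaLimitSet (xs (i + 1))).Nonempty) :
    ∀ w : Vec n → ℝ, IsBarabanov M w → ∃ lam > (0:ℝ), w = fun y => lam * v y := by
  intro w hw
  have hvn := hv.1
  have hwn := hw.1
  have : Nonempty (Fin n) := ⟨⟨0, hn⟩⟩
  obtain ⟨e, he⟩ := exists_ne (0 : Vec n)
  -- A maximizer of `w` on the unit sphere of `v` is the start of a solution extremal for both.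
  obtain ⟨y, hy, hmax⟩ := hvn.isCompact_sphere.exists_isMaxOn
    ⟨_, hvn.map_inv_smul_self he⟩ hwn.continuous.continuousOn
  replace hy : v y = 1 := hy
  have hy0 : y ≠ 0 := by
    rintro rfl
    simp [hvn.map_zero] at hy
  have hμ : 0 < w y := hwn.pos hy0
  have hle : ∀ z, w z ≤ w y * v z := by
    intro z
    rcases eq_or_ne z 0 with rfl | hz
    · simp [hvn.map_zero, hwn.map_zero]
    have hvz := hvn.pos hz
    have h : w ((v z)⁻¹ • z) ≤ w y := hmax (hvn.map_inv_smul_self hz)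
    rw [hwn.2.1, abs_of_pos (inv_pos.2 hvz), inv_mul_le_iff₀ hvz] at h
    linarith
  obtain ⟨x, hx, hx0, hxw⟩ := hw.2.2 y
  have hxv : ∀ t ≥ (0 : ℝ), v (x t) = 1 := by
    intro t ht
    refine le_antisymm ?_ ?_
    · simpa [hx0, hy] using hv.2.1 x hx t ht
    · have h := hle (x t)
      rw [hxw t ht] at h
      exact (le_mul_iff_one_le_right hμ).1 h
  obtain ⟨p, hp⟩ := omegaLimitSet_nonempty hvn.isCompact_sphere hxv
  have hpw : w p = w y := by
    obtain ⟨tk, htk, hlim⟩ := hp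
    refine tendsto_nhds_unique ((hwn.continuous.tendsto p).comp hlim) ?_
    refine tendsto_const_nhds.congr' ?_
    filter_upwards [htk.eventually_ge_atTop 0] with k hk
    exact (hxw _ hk).symm
  have mem_Ω : ∀ {x : ℝ → Vec n}, IsSolution M x → (∀ t ≥ (0 : ℝ), v (x t) = 1) →
      ∀ {q}, q ∈ omegaLimitSet x → q ∈ OmegaUnion M v := fun hx hxv _ hq =>
    Set.mem_biUnion (show _ ∈ {x : ℝ → Vec n | _} from ⟨hx, hxv⟩) hq
  have hconst : ∀ z₁ ∈ Ωh, ∀ z₂ ∈ Ωh, w z₁ = w z₂ := by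
    intro z₁ hz₁ z₂ hz₂
    obtain ⟨N, hN, xs, hxs, h₁, h₂, hcap⟩ := hchain z₁ hz₁ z₂ hz₂
    have hind : ∀ i, i < N → ∀ q ∈ omegaLimitSet (xs i), w z₁ = w q := by
      intro i
      induction i with
      | zero => exact fun hi q hq => hw.eq_of_mem_omegaLimitSet hcpt (hxs 0 hi).1 h₁ hq
      | succ i ih =>
        intro hi q hq
        obtain ⟨r, hr, hr'⟩ := hcap i hi
        exact (ih (Nat.lt_of_succ_lt hi) r hr).trans
          (hw.eq_of_mem_omegaLimitSet hcpt (hxs _ hi).1 hr' hq)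
    exact hind (N - 1) (Nat.sub_lt hN one_pos) z₂ h₂
  have hΩ : ∀ q ∈ OmegaUnion M v, w q = w y := by
    obtain ⟨z₀, hz₀⟩ : Ωh.Nonempty := closure_nonempty_iff.1 ⟨p, hdense (mem_Ω hx hxv hp)⟩
    have hcl : closure Ωh ⊆ {z | w z = w z₀} :=
      closure_minimal (fun z hz => hconst z hz z₀ hz₀)
        (isClosed_eq hwn.continuous continuous_const)
    intro q hq
    have h₁ : w q = w z₀ := hcl (hdense hq)
    have h₂ : w p = w z₀ := hcl (hdense (mem_Ω hx hxv hp))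
    rw [h₁, ← h₂, hpw]
  refine ⟨w y, hμ, funext fun z => le_antisymm (hle z) ?_⟩
  rcases eq_or_ne z 0 with rfl | hz
  · simp [hvn.map_zero, hwn.map_zero]
  have hvz := hvn.pos hz
  obtain ⟨u, hu, hu0, huv⟩ := hv.2.2 ((v z)⁻¹ • z)
  rw [hvn.map_inv_smul_self hz] at huv
  obtain ⟨q, hq⟩ := omegaLimitSet_nonempty hvn.isCompact_sphere huv
  have h := hw.le_of_mem_omegaLimitSet hcpt hu hq le_rfl
  rw [hΩ q (mem_Ω hu huv hq), hu0, hwn.2.1, abs_of_pos (inv_pos.2 hvz),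
    le_inv_mul_iff₀ hvz] at h
  linarith
end
end
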